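/- Let $n \geq 3$, let $a$ be a real number with $0 \leq a < \frac{n-2}{2}$, and set $p = \frac{2n}{n-2}$. Suppose $K > 0$ is a constant such that the Sobolev inequality $\left(\int_{\mathbb{R}^n} |f(x)|^p dx\right)^{1/p} \leq K \left(\int_{\mathbb{R}^n} \|\nabla f(x)\|^2 dx\right)^{1/2}$ holds for all $f \in C_c^\infty(\mathbb{R}^n \setminus \{0\})$. Then for every $u \in C_c^\infty(\mathbb{R}^n)$, $\left(\int_{\mathbb{R}^n} \frac{|u(x)|^p}{\|x\|^{ap}}\,dx\right)^{2/p} \leq K^2 \left(\frac{n-2}{n-2-2a}\right)^2 \int_{\mathbb{R}^n} \frac{\|\nabla u(x)\|^2}{\|x\|^{2a}}\,dx$. -/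

import Mathlib

open MeasureTheory

section CaffarelliKohnNirenberg

open Filter Topology Module
open scoped RealInnerProductSpace

variable {E : Type*} [NormedAddCommGroup E] [InnerProductSpace ℝ E]

lemma hasFDerivAt_norm_rpow_of_ne_zero {x : E} (hx : x ≠ 0) (s : ℝ) :
    HasFDerivAt (fun y : E => ‖y‖ ^ s) ((s * ‖x‖ ^ (s - 2)) • innerSL ℝ x) x := by
  have hpos : 0 < ‖x‖ := norm_pos_iff.2 hx
  have h := (hasStrictFDerivAt_norm_sq x).hasFDerivAt.rpow_const (p := s / 2)
    (Or.inl (by positivity))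
  have hpow (y : E) (t : ℝ) : (‖y‖ ^ 2) ^ (t / 2) = ‖y‖ ^ t := by
    rw [← Real.rpow_natCast_mul (norm_nonneg y)]
    congr 1
    push_cast
    ring
  have h2 : s / 2 - 1 = (s - 2) / 2 := by ring
  simp only [h2, hpow] at h
  convert! h using 1
  ext y
  simp
  ring

lemma contDiff_norm_rpow_mul {u : E → ℝ} {m : WithTop ℕ∞} (hu : ContDiff ℝ m u)
    (h0 : tsupport u ⊆ {(0 : E)}ᶜ) (s : ℝ) : ContDiff ℝ m (fun x => ‖x‖ ^ s * u x) := by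
  rw [contDiff_iff_contDiffAt]
  intro x
  by_cases hx : x ∈ tsupport u
  · have hx0 : x ≠ 0 := h0 hx
    exact ((contDiffAt_norm ℝ hx0).rpow_const_of_ne (norm_ne_zero_iff.2 hx0)).mul hu.contDiffAt
  · have h : (fun x => ‖x‖ ^ s * u x) =ᶠ[𝓝 x] fun _ => 0 := by
      filter_upwards [notMem_tsupport_iff_eventuallyEq.1 hx] with y hy
      simp [hy]
    exact contDiffAt_const.congr_of_eventuallyEq h

variable [FiniteDimensional ℝ E]

lemma norm_gradient_eq {f : E → ℝ} (x : E) : ‖gradient f x‖ = ‖fderiv ℝ f x‖ := by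
  rw [← toDual_gradient, LinearIsometryEquiv.norm_map]

lemma continuous_gradient {f : E → ℝ} (hf : ContDiff ℝ 1 f) : Continuous (gradient f) :=
  (InnerProductSpace.toDual ℝ E).symm.continuous.comp (hf.continuous_fderiv one_ne_zero)

variable [MeasurableSpace E] [BorelSpace E]

/-- The divergence theorem for the vector field `x ↦ w x • x`. -/
lemma integral_fderiv_apply_self {w : E → ℝ} (hw : ContDiff ℝ 1 w) (hc : HasCompactSupport w) :
    Integrable (fun x => fderiv ℝ w x x) ∧
      ∫ x, fderiv ℝ w x x = -(finrank ℝ E : ℝ) * ∫ x, w x := by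
  let b := stdOrthonormalBasis ℝ E
  have hcont : Continuous (fderiv ℝ w) := hw.continuous_fderiv one_ne_zero
  have hint (i) : Integrable (fun x => ⟪b i, x⟫ * fderiv ℝ w x (b i)) := by
    refine Continuous.integrable_of_hasCompactSupport (by fun_prop) ?_
    exact (hc.fderiv_apply (𝕜 := ℝ) (b i)).mul_left
  have hw_int : Integrable w := hw.continuous.integrable_of_hasCompactSupport hc
  have hfd (i) (x : E) : fderiv ℝ (fun x : E => ⟪b i, x⟫) x (b i) = 1 := by
    have : HasFDerivAt (fun x : E => ⟪b i, x⟫) (innerSL ℝ (b i)) x :=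
      (innerSL ℝ (b i)).hasFDerivAt
    rw [this.fderiv]
    simp
  have hparts (i) : ∫ x, ⟪b i, x⟫ * fderiv ℝ w x (b i) = -∫ x, w x := by
    rw [integral_mul_fderiv_eq_neg_fderiv_mul_of_integrable]
    · simp [hfd]
    · simpa [hfd] using hw_int
    · exact hint i
    · exact Continuous.integrable_of_hasCompactSupport
        ((by fun_prop : Continuous fun x : E => ⟪b i, x⟫).mul hw.continuous) hc.mul_left
    · intro x _
      exact ((innerSL ℝ (b i)).hasFDerivAt (x := x)).differentiableAt
    · intro x _
      exact hw.differentiable one_ne_zero x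
  have hsum : (fun x => fderiv ℝ w x x) = fun x => ∑ i, ⟪b i, x⟫ * fderiv ℝ w x (b i) := by
    ext x
    calc fderiv ℝ w x x = fderiv ℝ w x (∑ i, ⟪b i, x⟫ • b i) := by rw [b.sum_repr' x]
      _ = ∑ i, ⟪b i, x⟫ * fderiv ℝ w x (b i) := by simp only [map_sum, map_smul, smul_eq_mul]
  rw [hsum]
  refine ⟨integrable_finsetSum _ fun i _ => hint i, ?_⟩
  rw [integral_finsetSum _ fun i _ => hint i]
  simp [hparts]

variable {f : E → ℝ}

lemma integrable_norm_gradient_sq (hf : ContDiff ℝ 1 f) (hc : HasCompactSupport f) :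
    Integrable (fun x => ‖gradient f x‖ ^ 2) := by
  refine Continuous.integrable_of_hasCompactSupport ((continuous_gradient hf).norm.pow 2) ?_
  refine (hc.fderiv (𝕜 := ℝ)).mono fun x hx => ?_
  contrapose! hx
  simp_all [norm_gradient_eq]

lemma integral_norm_gradient_add_sq (hf : ContDiff ℝ 1 f) (hc : HasCompactSupport f)
    (h0 : tsupport f ⊆ {(0 : E)}ᶜ) (b : ℝ) :
    ∫ x, ‖gradient f x + (b * (‖x‖ ^ (-2 : ℝ) * f x)) • x‖ ^ 2 =
      (∫ x, ‖gradient f x‖ ^ 2) -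
        b * (finrank ℝ E - 2 - b) * ∫ x, ‖x‖ ^ (-2 : ℝ) * f x ^ 2 := by
  set w : E → ℝ := fun x => ‖x‖ ^ (-2 : ℝ) * f x ^ 2 with hw_def
  have hsub : tsupport (fun x => f x ^ 2) ⊆ tsupport f :=
    closure_mono fun x hx => by simpa using hx
  have hw : ContDiff ℝ 1 w := contDiff_norm_rpow_mul (hf.pow 2) (hsub.trans h0) _
  have hwc : HasCompactSupport w := hc.mono fun x hx => by
    contrapose! hx
    simp_all
  obtain ⟨hint, hdiv⟩ := integral_fderiv_apply_self hw hwc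
  have hwint : Integrable w := hw.continuous.integrable_of_hasCompactSupport hwc
  have hf0 : f 0 = 0 := image_eq_zero_of_notMem_tsupport fun h => h0 h rfl
  have hpt (x : E) : ‖gradient f x + (b * (‖x‖ ^ (-2 : ℝ) * f x)) • x‖ ^ 2 =
      ‖gradient f x‖ ^ 2 + (b * fderiv ℝ w x x + (2 * b + b ^ 2) * w x) := by
    rcases eq_or_ne x 0 with rfl | hx
    · simp [hw_def, hf0]
    have hpos : 0 < ‖x‖ := norm_pos_iff.2 hx
    have hfx : HasFDerivAt f (fderiv ℝ f x) x := (hf.differentiable one_ne_zero x).hasFDerivAt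
    have hd := (hasFDerivAt_norm_rpow_of_ne_zero hx (-2)).mul (hfx.pow 2)
    have hd' : fderiv ℝ w x x = -2 * w x + 2 * (‖x‖ ^ (-2 : ℝ) * f x * fderiv ℝ f x x) := by
      rw [show fderiv ℝ w x = _ from hd.fderiv]
      have : ‖x‖ ^ (-2 - 2 : ℝ) * ‖x‖ ^ 2 = ‖x‖ ^ (-2 : ℝ) := by
        rw [← Real.rpow_natCast, ← Real.rpow_add hpos]
        norm_num
      simp only [hw_def, _root_.add_apply, _root_.smul_apply, smul_eq_mul, nsmul_eq_mul,
        innerSL_apply_apply, real_inner_self_eq_norm_sq, pow_one, Nat.cast_ofNat, Nat.add_one_sub_one]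
      linear_combination (-2 * f x ^ 2) * this
    have h2 : ‖x‖ ^ (-2 : ℝ) * ‖x‖ ^ 2 = 1 := by
      rw [← Real.rpow_natCast, ← Real.rpow_add hpos]
      norm_num
    rw [norm_add_sq_real, real_inner_smul_right, inner_gradient_left, norm_smul, mul_pow, hd',
      Real.norm_eq_abs, sq_abs]
    simp only [hw_def]
    linear_combination (b ^ 2 * ‖x‖ ^ (-2 : ℝ) * f x ^ 2) * h2
  have hsum : Integrable (fun x => b * fderiv ℝ w x x + (2 * b + b ^ 2) * w x) :=
    (hint.const_mul _).add (hwint.const_mul _)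
  simp_rw [hpt]
  rw [integral_add (integrable_norm_gradient_sq hf hc) hsum, integral_add (hint.const_mul _) (hwint.const_mul _), integral_const_mul, integral_const_mul,
    hdiv]
  ring

lemma integral_norm_gradient_sq_le (hf : ContDiff ℝ 1 f) (hc : HasCompactSupport f)
    (h0 : tsupport f ⊆ {(0 : E)}ᶜ) {a : ℝ} (ha0 : 0 ≤ a)
    (ha : a < ((finrank ℝ E : ℝ) - 2) / 2) :
    ∫ x, ‖gradient f x‖ ^ 2 ≤
      (((finrank ℝ E : ℝ) - 2) / ((finrank ℝ E : ℝ) - 2 - 2 * a)) ^ 2 *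
        ∫ x, ‖gradient f x + (a * (‖x‖ ^ (-2 : ℝ) * f x)) • x‖ ^ 2 := by
  rw [integral_norm_gradient_add_sq hf hc h0]
  have hhardy : 0 ≤ ∫ x,
      ‖gradient f x + ((((finrank ℝ E : ℝ) - 2) / 2) * (‖x‖ ^ (-2 : ℝ) * f x)) • x‖ ^ 2 :=
    integral_nonneg fun x => by positivity
  rw [integral_norm_gradient_add_sq hf hc h0] at hhardy
  set d : ℝ := (finrank ℝ E : ℝ) - 2
  set G := ∫ x, ‖gradient f x‖ ^ 2
  set H := ∫ x, ‖x‖ ^ (-2 : ℝ) * f x ^ 2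
  have hd : 0 < d - 2 * a := by linarith
  rw [div_pow, div_mul_eq_mul_div, le_div_iff₀ (by positivity)]
  have h : 0 ≤ 4 * a * (d - a) * (G - d / 2 * (d - d / 2) * H) :=
    mul_nonneg (mul_nonneg (by positivity) (by linarith)) hhardy
  linear_combination h


lemma ckn_of_tsupport_subset_compl_zero {a p K : ℝ} (ha0 : 0 ≤ a)
    (ha : a < ((finrank ℝ E : ℝ) - 2) / 2)
    (hSobolev : ∀ f : E → ℝ, ContDiff ℝ (⊤ : ℕ∞) f →
      HasCompactSupport f → tsupport f ⊆ {(0 : E)}ᶜ →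
      (∫ x, |f x| ^ p) ^ (1 / p) ≤ K * (∫ x, ‖gradient f x‖ ^ 2) ^ ((1 : ℝ) / 2))
    {u : E → ℝ} (hu : ContDiff ℝ (⊤ : ℕ∞) u) (hc : HasCompactSupport u)
    (h0 : tsupport u ⊆ {(0 : E)}ᶜ) :
    (∫ x, |u x| ^ p / ‖x‖ ^ (a * p)) ^ (2 / p) ≤
      K ^ 2 * (((finrank ℝ E : ℝ) - 2) / ((finrank ℝ E : ℝ) - 2 - 2 * a)) ^ 2 *
        ∫ x, ‖gradient u x‖ ^ 2 / ‖x‖ ^ (2 * a) := by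
  set f : E → ℝ := fun x => ‖x‖ ^ (-a) * u x with hf_def
  have hsub : tsupport f ⊆ tsupport u := tsupport_mul_subset_right
  have hf : ContDiff ℝ (⊤ : ℕ∞) f := contDiff_norm_rpow_mul hu h0 _
  have hf1 : ContDiff ℝ 1 f := hf.of_le (by exact_mod_cast le_top)
  have hfc : HasCompactSupport f := hc.mul_left
  have hf0 : tsupport f ⊆ {(0 : E)}ᶜ := hsub.trans h0
  have h0u : (0 : E) ∉ tsupport u := fun h => h0 h rfl
  have hL : ∫ x, |u x| ^ p / ‖x‖ ^ (a * p) = ∫ x, |f x| ^ p := by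
    refine integral_congr_ae (.of_forall fun x => ?_)
    simp only [hf_def]
    rw [abs_mul, abs_of_nonneg (by positivity : 0 ≤ ‖x‖ ^ (-a)),
      Real.mul_rpow (by positivity) (abs_nonneg _),
      ← Real.rpow_mul (norm_nonneg x), neg_mul, Real.rpow_neg (norm_nonneg x)]
    ring
  have hR : ∫ x, ‖gradient u x‖ ^ 2 / ‖x‖ ^ (2 * a) =
      ∫ x, ‖gradient f x + (a * (‖x‖ ^ (-2 : ℝ) * f x)) • x‖ ^ 2 := by
    refine integral_congr_ae (.of_forall fun x => ?_)
    rcases eq_or_ne x 0 with rfl | hx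
    · simp [norm_gradient_eq, fderiv_of_notMem_tsupport ℝ h0u,
        fderiv_of_notMem_tsupport ℝ fun h => h0u (hsub h)]
    have hpos : 0 < ‖x‖ := norm_pos_iff.2 hx
    have hgrad : gradient f x + (a * (‖x‖ ^ (-2 : ℝ) * f x)) • x =
        ‖x‖ ^ (-a) • gradient u x := by
      apply (InnerProductSpace.toDual ℝ E).injective
      have hux : HasFDerivAt u (fderiv ℝ u x) x := (hu.differentiable (by simp) x).hasFDerivAt
      have hd : fderiv ℝ f x = _ := ((hasFDerivAt_norm_rpow_of_ne_zero hx (-a)).mul hux).fderiv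
      have hpow : ‖x‖ ^ (-a - 2) = ‖x‖ ^ (-a) * ‖x‖ ^ (-2 : ℝ) := by
        rw [← Real.rpow_add hpos]
        ring_nf
      ext y
      rw [map_add, toDual_gradient, hd]
      simp only [hf_def, _root_.add_apply, _root_.smul_apply, map_smul,
        smul_eq_mul, InnerProductSpace.toDual_apply_apply, innerSL_apply_apply,
        inner_gradient_left, hpow]
      ring
    simp only
    rw [hgrad, norm_smul, mul_pow, Real.norm_of_nonneg (by positivity), ← Real.rpow_mul_natCast
      (norm_nonneg x), mul_comm 2 a, div_eq_inv_mul, ← Real.rpow_neg (norm_nonneg x)]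
    simp
  have hG := integral_norm_gradient_sq_le hf1 hfc hf0 ha0 ha
  have hS := hSobolev f hf hfc hf0
  rw [hL, hR, mul_assoc]
  refine le_trans ?_ (mul_le_mul_of_nonneg_left hG (sq_nonneg K))
  have hI : 0 ≤ ∫ x, |f x| ^ p := integral_nonneg fun x => by positivity
  have hJ : 0 ≤ ∫ x, ‖gradient f x‖ ^ 2 := integral_nonneg fun x => by positivity
  have hS2 := pow_le_pow_left₀ (by positivity) hS 2
  rw [mul_pow, ← Real.rpow_mul_natCast hI, ← Real.rpow_mul_natCast hJ] at hS2
  convert hS2 using 2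
  · push_cast
    ring
  · norm_num

lemma integrable_div_norm_rpow (hd : 1 ≤ finrank ℝ E) {s : ℝ} (hs : s < finrank ℝ E)
    {g : E → ℝ} (hg : Continuous g) (hc : HasCompactSupport g) :
    Integrable (fun x => g x / ‖x‖ ^ s) := by
  have h : LocallyIntegrable (fun x : E => ‖x‖ ^ (-s)) := by
    refine locallyIntegrable_of_norm_le_rpow (C := 1) hd hs (.of_forall fun x => ?_)
      (continuous_norm.measurable.pow_const _).aestronglyMeasurable
    rw [Real.norm_of_nonneg (by positivity), one_mul]
  refine (h.integrable_smul_left_of_hasCompactSupport hg hc).congr (.of_forall fun x => ?_)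
  simp only
  rw [Real.rpow_neg (norm_nonneg x), smul_eq_mul, div_eq_mul_inv]

omit [MeasurableSpace E] [BorelSpace E] in
lemma exists_cutoff_near_zero : ∃ (φ : ℕ → E → ℝ) (C : ℝ), ∀ k,
    ContDiff ℝ (⊤ : ℕ∞) (φ k) ∧ (0 : E) ∉ tsupport (φ k) ∧
    (∀ x, ‖φ k x‖ ≤ 1) ∧ (∀ x, ‖fderiv ℝ (φ k) x‖ * ‖x‖ ≤ C) ∧
    ∀ x, 2 < (k + 1) * ‖x‖ → φ k =ᶠ[𝓝 x] fun _ => 1 := by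
  let β : ContDiffBump (0 : E) := ⟨1, 2, one_pos, one_lt_two⟩
  let ψ : E → ℝ := fun x => 1 - β x
  have hψ : ContDiff ℝ (⊤ : ℕ∞) ψ := contDiff_const.sub β.contDiff
  have hcont : Continuous fun x : E => ‖fderiv ℝ ψ x‖ * ‖x‖ :=
    (hψ.continuous_fderiv (by simp)).norm.mul continuous_norm
  have hcomp : HasCompactSupport fun x : E => ‖fderiv ℝ ψ x‖ * ‖x‖ := by
    have : fderiv ℝ ψ = fun x => -fderiv ℝ β x := by
      ext1 x
      exact fderiv_const_sub _
    rw [this]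
    simp_rw [norm_neg]
    exact (β.hasCompactSupport.fderiv (𝕜 := ℝ)).norm.mul_right
  obtain ⟨C, hC⟩ := hcomp.exists_bound_of_continuous hcont
  refine ⟨fun k x => ψ ((k + 1 : ℝ) • x), C, fun k => ?_⟩
  have hk : (0 : ℝ) < k + 1 := by positivity
  refine ⟨hψ.comp (contDiff_const_smul _), ?_, fun x => ?_, fun x => ?_, fun x hx => ?_⟩
  · rw [notMem_tsupport_iff_eventuallyEq]
    have hlim : Tendsto (fun x : E => (k + 1 : ℝ) • x) (𝓝 0) (𝓝 0) := by
      have : Continuous fun x : E => (k + 1 : ℝ) • x := continuous_const_smul _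
      simpa using this.tendsto 0
    filter_upwards [hlim.eventually β.eventuallyEq_one] with x hx
    simp [ψ, hx]
  · rw [Real.norm_eq_abs, abs_le]
    constructor <;> simp only [ψ] <;> linarith [β.nonneg' ((k + 1 : ℝ) • x),
      β.le_one (x := (k + 1 : ℝ) • x)]
  · have h := hC ((k + 1 : ℝ) • x)
    rw [norm_mul, norm_norm, norm_norm, norm_smul, Real.norm_of_nonneg hk.le] at h
    rw [show fderiv ℝ (fun x => ψ ((k + 1 : ℝ) • x)) x =
      (k + 1 : ℝ) • fderiv ℝ ψ ((k + 1 : ℝ) • x) from fderiv_comp_smul _, norm_smul,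
      Real.norm_of_nonneg hk.le]
    linarith
  · have hopen : ∀ᶠ y : E in 𝓝 x, 2 < (k + 1) * ‖y‖ :=
      (by fun_prop : Continuous fun y : E => (k + 1) * ‖y‖).continuousAt.eventually_const_lt hx
    filter_upwards [hopen] with y hy
    have : β ((k + 1 : ℝ) • y) = 0 := by
      apply β.zero_of_le_dist
      rw [dist_zero_right, norm_smul, Real.norm_of_nonneg hk.le]
      exact hy.le
    simp [ψ, this]

lemma ckn_of_sobolev (hd : 1 ≤ finrank ℝ E) {a p K : ℝ} (ha0 : 0 ≤ a)
    (ha : a < ((finrank ℝ E : ℝ) - 2) / 2) (hp : 0 < p) (hap : a * p < finrank ℝ E)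
    (hSobolev : ∀ f : E → ℝ, ContDiff ℝ (⊤ : ℕ∞) f →
      HasCompactSupport f → tsupport f ⊆ {(0 : E)}ᶜ →
      (∫ x, |f x| ^ p) ^ (1 / p) ≤ K * (∫ x, ‖gradient f x‖ ^ 2) ^ ((1 : ℝ) / 2))
    {u : E → ℝ} (hu : ContDiff ℝ (⊤ : ℕ∞) u) (hc : HasCompactSupport u) :
    (∫ x, |u x| ^ p / ‖x‖ ^ (a * p)) ^ (2 / p) ≤
      K ^ 2 * (((finrank ℝ E : ℝ) - 2) / ((finrank ℝ E : ℝ) - 2 - 2 * a)) ^ 2 *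
        ∫ x, ‖gradient u x‖ ^ 2 / ‖x‖ ^ (2 * a) := by
  have : Nontrivial E := Module.nontrivial_of_finrank_pos (R := ℝ) (by omega)
  obtain ⟨φ, C, hφ⟩ := exists_cutoff_near_zero (E := E)
  choose hφ_smooth hφ_zero hφ_le hφ_deriv hφ_one using hφ
  have hmain (k : ℕ) := ckn_of_tsupport_subset_compl_zero (E := E) ha0 ha
    hSobolev ((hφ_smooth k).mul hu) hc.mul_left (by
      intro x hx hx0
      rw [Set.mem_singleton_iff.1 hx0] at hx
      exact hφ_zero k (tsupport_mul_subset_left hx))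
  have hae : ∀ᵐ x : E, x ≠ 0 := by simp [ae_iff]
  have hev (x : E) (hx : x ≠ 0) : ∀ᶠ k : ℕ in atTop,
      (fun y => φ k y * u y) =ᶠ[𝓝 x] u := by
    have hlim : Tendsto (fun k : ℕ => ((k : ℝ) + 1) * ‖x‖) atTop atTop :=
      (tendsto_atTop_add_const_right _ _ tendsto_natCast_atTop_atTop).atTop_mul_const
        (norm_pos_iff.2 hx)
    filter_upwards [hlim.eventually_gt_atTop 2] with k hk
    filter_upwards [hφ_one k x hk] with y hy
    simp [hy]
  have hu1 : Continuous (fderiv ℝ u) := hu.continuous_fderiv (by simp)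
  have hlimL : Tendsto (fun k => ∫ x, |φ k x * u x| ^ p / ‖x‖ ^ (a * p)) atTop
      (𝓝 (∫ x, |u x| ^ p / ‖x‖ ^ (a * p))) := by
    refine tendsto_integral_of_dominated_convergence (fun x => |u x| ^ p / ‖x‖ ^ (a * p))
      (fun k => ?_) ?_ (fun k => ?_) ?_
    · have := (hφ_smooth k).continuous.measurable
      have := hu.continuous.measurable
      exact Measurable.aestronglyMeasurable (by fun_prop)
    · refine integrable_div_norm_rpow hd hap
        (hu.continuous.abs.rpow_const fun _ => Or.inr hp.le) ?_
      exact hc.mono fun x hx => by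
        contrapose! hx
        simp_all [Real.zero_rpow hp.ne']
    · refine .of_forall fun x => ?_
      rw [Real.norm_of_nonneg (by positivity)]
      refine div_le_div_of_nonneg_right (Real.rpow_le_rpow (abs_nonneg _) ?_ hp.le) (by positivity)
      rw [abs_mul]
      exact mul_le_of_le_one_left (abs_nonneg _) (hφ_le k x)
    · filter_upwards [hae] with x hx
      refine tendsto_const_nhds.congr' ?_
      filter_upwards [hev x hx] with k hk
      rw [hk.eq_of_nhds]
  have hlimR : Tendsto
      (fun k => ∫ x, ‖gradient (fun y => φ k y * u y) x‖ ^ 2 / ‖x‖ ^ (2 * a)) atTop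
      (𝓝 (∫ x, ‖gradient u x‖ ^ 2 / ‖x‖ ^ (2 * a))) := by
    refine tendsto_integral_of_dominated_convergence (fun x => 2 * ‖fderiv ℝ u x‖ ^ 2 /
      ‖x‖ ^ (2 * a) + 2 * C ^ 2 * u x ^ 2 / ‖x‖ ^ (2 * a + 2)) (fun k => ?_) ?_ (fun k => ?_) ?_
    · have := ((hφ_smooth k).mul hu).continuous_fderiv (by simp)
      have := this.measurable
      simp_rw [norm_gradient_eq]
      exact Measurable.aestronglyMeasurable (by fun_prop)
    · refine (integrable_div_norm_rpow hd (by linarith) (by fun_prop) ?_).add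
        (integrable_div_norm_rpow hd (by linarith) ?_ ?_)
      · exact (hc.fderiv (𝕜 := ℝ)).mono fun x hx => by
          contrapose! hx
          simp_all
      · exact (hu.continuous.pow 2).const_mul _
      · exact hc.mono fun x hx => by
          contrapose! hx
          simp_all
    · filter_upwards [hae] with x hx
      have hpos : 0 < ‖x‖ := norm_pos_iff.2 hx
      rw [Real.norm_of_nonneg (by positivity), norm_gradient_eq, Real.rpow_add hpos,
        Real.rpow_two, mul_comm (‖x‖ ^ (2 * a)), ← div_div _ (‖x‖ ^ 2), ← add_div]
      gcongr
      have hfd : fderiv ℝ (fun y => φ k y * u y) x = _ :=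
        fderiv_fun_mul ((hφ_smooth k).differentiable (by simp) x) (hu.differentiable (by simp) x)
      have hb : ‖fderiv ℝ (fun y => φ k y * u y) x‖ ≤ ‖fderiv ℝ u x‖ + C * |u x| / ‖x‖ := by
        rw [hfd]
        refine (norm_add_le _ _).trans (add_le_add ?_ ?_)
        · rw [norm_smul]
          exact mul_le_of_le_one_left (norm_nonneg _) (hφ_le k x)
        · rw [norm_smul, le_div_iff₀ hpos, Real.norm_eq_abs]
          nlinarith [mul_le_mul_of_nonneg_left (hφ_deriv k x) (abs_nonneg (u x))]
      refine (pow_le_pow_left₀ (norm_nonneg _) hb 2).trans (add_sq_le.trans_eq ?_)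
      rw [div_pow, mul_pow, sq_abs]
      ring
    · filter_upwards [hae] with x hx
      refine tendsto_const_nhds.congr' ?_
      filter_upwards [hev x hx] with k hk
      rw [hk.gradient_eq]
  exact le_of_tendsto_of_tendsto' (hlimL.rpow_const (Or.inr (by positivity)))
    (hlimR.const_mul _) hmain

end CaffarelliKohnNirenberg

/-- Caffarelli-Kohn-Nirenberg inequality in the endpoint case `b = a` with
`a ≥ 0`, assuming the Sobolev inequality with constant `K`. -/
theorem ckn_b_eq_a_nonneg (n : ℕ) (hn : 3 ≤ n) (a p : ℝ)
    (ha0 : 0 ≤ a) (ha : a < ((n : ℝ) - 2) / 2) (hp : p = 2 * n / ((n : ℝ) - 2))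
    (K : ℝ) (hK : 0 < K)
    (hSobolev : ∀ f : EuclideanSpace ℝ (Fin n) → ℝ, ContDiff ℝ (⊤ : ℕ∞) f →
      HasCompactSupport f → tsupport f ⊆ {(0 : EuclideanSpace ℝ (Fin n))}ᶜ →
      (∫ x, |f x| ^ p) ^ (1 / p) ≤ K * (∫ x, ‖gradient f x‖ ^ 2) ^ ((1 : ℝ) / 2))
    (u : EuclideanSpace ℝ (Fin n) → ℝ)
    (hu : ContDiff ℝ (⊤ : ℕ∞) u) (hsupp : HasCompactSupport u) :
    (∫ x, |u x| ^ p / ‖x‖ ^ (a * p)) ^ (2 / p) ≤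
      K ^ 2 * (((n : ℝ) - 2) / ((n : ℝ) - 2 - 2 * a)) ^ 2 *
        ∫ x, ‖gradient u x‖ ^ 2 / ‖x‖ ^ (2 * a) := by
  have hn3 : (3 : ℝ) ≤ n := by exact_mod_cast hn
  have hn2 : (0 : ℝ) < n - 2 := by linarith
  have hap : a * p < n := by
    rw [hp, mul_div_assoc', div_lt_iff₀ hn2]
    nlinarith
  have hfin : Module.finrank ℝ (EuclideanSpace ℝ (Fin n)) = n := by simp
  have h := ckn_of_sobolev (E := EuclideanSpace ℝ (Fin n)) (by omega) ha0 (by rwa [hfin])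
    (by rw [hp]; positivity) (by rwa [hfin]) hSobolev hu hsupp
  rwa [hfin] at h
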